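/- Let m, m' be in M_{(b_i);(c_j)} with associated longest double-coset representatives w_m, w_{m'}. Then w_m ≤ w_{m'} in Bruhat order if and only if m_{≤i,≥j} ≤ m'_{≤i,≥j} for all i in [1,n] and j in [1,n']. -/

import Mathlib

open Equiv Finset

/-- `s` is one of the standard Coxeter generators (adjacent transpositions) of `S_d`. -/
def IsAdjTrans {d : ℕ} (s : Perm (Fin d)) : Prop :=
  ∃ (i : ℕ) (h : i + 1 < d), s = Equiv.swap ⟨i, Nat.lt_of_succ_lt h⟩ ⟨i + 1, h⟩

/-- Coxeter length: minimal length of an expression of `w` as a product of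
adjacent transpositions. -/
noncomputable def len {d : ℕ} (w : Perm (Fin d)) : ℕ :=
  sInf {n | ∃ l : List (Perm (Fin d)),
    l.length = n ∧ (∀ s ∈ l, IsAdjTrans s) ∧ l.prod = w}

/-- Bruhat order: `y ≤ w` iff some reduced word for `w` has a subword with product `y`. -/
def BruhatLE {d : ℕ} (y w : Perm (Fin d)) : Prop :=
  ∃ l : List (Perm (Fin d)), (∀ s ∈ l, IsAdjTrans s) ∧ l.length = len w ∧ l.prod = w ∧
    ∃ l' : List (Perm (Fin d)), List.Sublist l' l ∧ l'.prod = y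

/-- `inv_a(w) = |{a' < a : w(a') > w(a)}|`. -/
def invi {d : ℕ} (w : Perm (Fin d)) (a : Fin d) : ℕ :=
  (Finset.univ.filter (fun a' => a' < a ∧ w a < w a')).card

/-- `m` lies in `M_{(b_i);(c_j)}`: an `n × n'` matrix of nonnegative integers
with row sums `b i` and column sums `c j`. -/
def MemM {n n' : ℕ} (b : Fin n → ℕ) (c : Fin n' → ℕ) (m : Fin n → Fin n' → ℕ) : Prop :=
  (∀ i, ∑ j, m i j = b i) ∧ (∀ j, ∑ i, m i j = c j)

/-- The block `B_i ⊆ [1,d]`: the `i`-th consecutive interval, of size `b i`. -/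
def block (d : ℕ) {n : ℕ} (b : Fin n → ℕ) (i : Fin n) : Finset (Fin d) :=
  Finset.univ.filter (fun x : Fin d =>
    ∑ i' ∈ Finset.univ.filter (fun i' => i' < i), b i' ≤ (x : ℕ) ∧
    (x : ℕ) < ∑ i' ∈ Finset.univ.filter (fun i' => i' ≤ i), b i')

/-- `ψ(w)_{i,j} = |w(B_i) ∩ C_j|`. -/
def psi (d : ℕ) {n n' : ℕ} (b : Fin n → ℕ) (c : Fin n' → ℕ) (w : Perm (Fin d)) :
    Fin n → Fin n' → ℕ :=
  fun i j => ((block d b i).filter (fun x => w x ∈ block d c j)).card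

/-- `w` lies in the parabolic subgroup preserving each block `B_i` separately. -/
def PreservesBlocks (d : ℕ) {n : ℕ} (b : Fin n → ℕ) (w : Perm (Fin d)) : Prop :=
  ∀ i : Fin n, ∀ x ∈ block d b i, w x ∈ block d b i

/-- `m_{≤i,≥j} = Σ_{i'≤i, j'≥j} m_{i',j'}`. -/
def sUR {n n' : ℕ} (m : Fin n → Fin n' → ℕ) (i : Fin n) (j : Fin n') : ℕ :=
  ∑ i' ∈ Finset.univ.filter (fun i' => i' ≤ i),
    ∑ j' ∈ Finset.univ.filter (fun j' => j ≤ j'), m i' j'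

/-- `m_{≥i,≤j} = Σ_{i'≥i, j'≤j} m_{i',j'}`. -/
def sLL {n n' : ℕ} (m : Fin n → Fin n' → ℕ) (i : Fin n) (j : Fin n') : ℕ :=
  ∑ i' ∈ Finset.univ.filter (fun i' => i ≤ i'),
    ∑ j' ∈ Finset.univ.filter (fun j' => j' ≤ j), m i' j'


/-- rank function -/
def rk {d : ℕ} (w : Perm (Fin d)) (p q : ℕ) : ℕ :=
  (Finset.univ.filter (fun x : Fin d => (x : ℕ) < p ∧ q ≤ (w x : ℕ))).card

/-- step of the rank function -/
def stp {d : ℕ} (w : Perm (Fin d)) (q p : ℕ) : ℕ :=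
  if h : p < d then (if q ≤ (w ⟨p, h⟩ : ℕ) then 1 else 0) else 0

lemma rk_succ {d : ℕ} (w : Perm (Fin d)) (p q : ℕ) :
    rk w (p + 1) q = rk w p q + stp w q p := by
  unfold rk stp
  split_ifs with h h2
  · rw [← Finset.card_insert_of_notMem (a := (⟨p, h⟩ : Fin d))]
    · congr 1
      ext x
      simp only [mem_filter, mem_univ, true_and, mem_insert, Fin.ext_iff]
      constructor
      · rintro ⟨h3, h4⟩
        by_cases h5 : (x : ℕ) = p
        · left; exact h5
        · right; exact ⟨by omega, h4⟩
      · rintro (h3 | h3)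
        · have : x = ⟨p, h⟩ := Fin.ext h3
          subst this
          exact ⟨by simp, h2⟩
        · exact ⟨by omega, h3.2⟩
    · simp
  · rw [add_zero]
    congr 1
    ext x
    simp only [mem_filter, mem_univ, true_and]
    constructor
    · rintro ⟨h3, h4⟩
      refine ⟨?_, h4⟩
      by_contra h5
      have : x = ⟨p, h⟩ := Fin.ext (by simp; omega)
      subst this
      exact h2 h4
    · rintro ⟨h3, h4⟩
      exact ⟨by omega, h4⟩
  · rw [add_zero]
    congr 1
    ext x
    have := x.2
    simp only [mem_filter, mem_univ, true_and]
    constructor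
    · rintro ⟨h3, h4⟩
      exact ⟨by omega, h4⟩
    · rintro ⟨h3, h4⟩
      exact ⟨by omega, h4⟩

lemma stp_le {d : ℕ} (w : Perm (Fin d)) (q p : ℕ) : stp w q p ≤ 1 := by
  unfold stp; split_ifs <;> simp

lemma stp_desc {d : ℕ} (w : Perm (Fin d)) (q i : ℕ) (h : i + 1 < d)
    (hd : w ⟨i + 1, h⟩ < w ⟨i, Nat.lt_of_succ_lt h⟩) : stp w q (i + 1) ≤ stp w q i := by
  have hd' : (w ⟨i + 1, h⟩ : ℕ) < w ⟨i, Nat.lt_of_succ_lt h⟩ := hd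
  unfold stp
  rw [dif_pos h, dif_pos (Nat.lt_of_succ_lt h)]
  split_ifs <;> omega

lemma stp_asc {d : ℕ} (w : Perm (Fin d)) (q i : ℕ) (h : i + 1 < d)
    (hd : w ⟨i, Nat.lt_of_succ_lt h⟩ < w ⟨i + 1, h⟩) : stp w q i ≤ stp w q (i + 1) := by
  have hd' : (w ⟨i, Nat.lt_of_succ_lt h⟩ : ℕ) < w ⟨i + 1, h⟩ := hd
  unfold stp
  rw [dif_pos h, dif_pos (Nat.lt_of_succ_lt h)]
  split_ifs <;> omega

lemma rk_zero {d : ℕ} (w : Perm (Fin d)) (q : ℕ) : rk w 0 q = 0 := by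
  simp [rk]

lemma rk_big_q {d : ℕ} (w : Perm (Fin d)) (p q : ℕ) (h : d ≤ q) : rk w p q = 0 := by
  unfold rk
  rw [Finset.card_eq_zero, Finset.filter_eq_empty_iff]
  intro x _
  have := (w x).2
  omega

lemma rk_big_p {d : ℕ} (w : Perm (Fin d)) (p q : ℕ) (h : d ≤ p) : rk w p q = rk w d q := by
  unfold rk
  congr 1
  ext x
  have := x.2
  simp only [mem_filter, mem_univ, true_and]
  constructor <;> rintro ⟨h3, h4⟩ <;> exact ⟨by omega, h4⟩

/-- adjacent transposition -/
def adj {d : ℕ} (i : ℕ) (h : i + 1 < d) : Perm (Fin d) :=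
  Equiv.swap ⟨i, Nat.lt_of_succ_lt h⟩ ⟨i + 1, h⟩

lemma adj_val {d : ℕ} (i : ℕ) (h : i + 1 < d) (x : Fin d) :
    ((adj i h x : Fin d) : ℕ) = if (x : ℕ) = i then i + 1 else if (x : ℕ) = i + 1 then i else x := by
  unfold adj
  rw [Equiv.swap_apply_def]
  simp only [Fin.ext_iff]
  split_ifs <;> simp

lemma adj_mul {d : ℕ} (i : ℕ) (h : i + 1 < d) : adj i h * adj i h = 1 := by
  unfold adj; exact Equiv.swap_mul_self _ _

lemma adj_adj {d : ℕ} (i : ℕ) (h : i + 1 < d) (x : Fin d) : adj i h (adj i h x) = x := by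
  unfold adj; simp

lemma adj_left {d : ℕ} (i : ℕ) (h : i + 1 < d) :
    adj i h ⟨i, Nat.lt_of_succ_lt h⟩ = ⟨i + 1, h⟩ := by unfold adj; simp

lemma adj_right {d : ℕ} (i : ℕ) (h : i + 1 < d) :
    adj i h ⟨i + 1, h⟩ = ⟨i, Nat.lt_of_succ_lt h⟩ := by unfold adj; simp

lemma rk_mul_adj {d : ℕ} (w : Perm (Fin d)) (i : ℕ) (h : i + 1 < d) (p q : ℕ) (hp : p ≠ i + 1) :
    rk (w * adj i h) p q = rk w p q := by
  unfold rk
  apply Finset.card_equiv (adj i h)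
  intro x
  rw [mem_filter, mem_filter]
  simp only [mem_univ, true_and, Perm.mul_apply]
  have : ((adj i h x : Fin d) : ℕ) < p ↔ (x : ℕ) < p := by
    rw [adj_val]; split_ifs <;> omega
  rw [this]

/-- rank dominance -/
def Dom {d : ℕ} (y w : Perm (Fin d)) : Prop := ∀ p q, rk y p q ≤ rk w p q

lemma dom_of_desc {d : ℕ} (y w : Perm (Fin d)) (i : ℕ) (h : i + 1 < d)
    (hd : w ⟨i + 1, h⟩ < w ⟨i, Nat.lt_of_succ_lt h⟩)
    (H : ∀ p q, p ≠ i + 1 → rk y p q ≤ rk w p q) : Dom y w := by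
  intro p q
  by_cases hp : p = i + 1
  · subst hp
    have h1 := H i q (by omega)
    have h2 := H (i + 1 + 1) q (by omega)
    simp only [rk_succ] at h2 ⊢
    have := stp_desc w q i h hd
    have := stp_le w q i
    have := stp_le y q i
    have := stp_le w q (i + 1)
    omega
  · exact H p q hp

lemma dom_of_asc {d : ℕ} (y w : Perm (Fin d)) (i : ℕ) (h : i + 1 < d)
    (hd : y ⟨i, Nat.lt_of_succ_lt h⟩ < y ⟨i + 1, h⟩)
    (H : ∀ p q, p ≠ i + 1 → rk y p q ≤ rk w p q) : Dom y w := by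
  intro p q
  by_cases hp : p = i + 1
  · subst hp
    have h1 := H i q (by omega)
    have h2 := H (i + 1 + 1) q (by omega)
    simp only [rk_succ] at h2 ⊢
    have := stp_asc y q i h hd
    have := stp_le w q i
    have := stp_le y q (i + 1)
    have := stp_le w q (i + 1)
    omega
  · exact H p q hp

/-- inversion set -/
def invs {d : ℕ} (w : Perm (Fin d)) : Finset (Fin d × Fin d) :=
  Finset.univ.filter (fun x => x.1 < x.2 ∧ w x.2 < w x.1)

lemma mem_invs {d : ℕ} (w : Perm (Fin d)) (a b : Fin d) :
    (a, b) ∈ invs w ↔ a < b ∧ w b < w a := by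
  simp [invs]

lemma invs_asc {d : ℕ} (w : Perm (Fin d)) (i : ℕ) (h : i + 1 < d)
    (hd : w ⟨i, Nat.lt_of_succ_lt h⟩ < w ⟨i + 1, h⟩) :
    (invs (w * adj i h)).card = (invs w).card + 1 := by
  have hinj : Function.Injective (fun x : Fin d × Fin d => (adj i h x.1, adj i h x.2)) := by
    rintro ⟨a, b⟩ ⟨a', b'⟩ hh
    simpa using hh
  rw [← Finset.card_image_of_injective (invs w) hinj,
    ← Finset.card_insert_of_notMem
      (a := ((⟨i, Nat.lt_of_succ_lt h⟩, ⟨i + 1, h⟩) : Fin d × Fin d))]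
  · congr 1
    ext ⟨a, b⟩
    have key : (a, b) ∈ (invs w).image (fun x : Fin d × Fin d => (adj i h x.1, adj i h x.2)) ↔
        (adj i h a, adj i h b) ∈ invs w := by
      simp only [mem_image, Prod.mk.injEq, Prod.exists]
      constructor
      · rintro ⟨a', b', h1, rfl, rfl⟩
        simpa [adj_adj] using h1
      · intro h1
        exact ⟨_, _, h1, adj_adj _ _ _, adj_adj _ _ _⟩
    rw [mem_insert, key]
    simp only [mem_invs, Perm.mul_apply, Prod.mk.injEq]
    by_cases hab : a = ⟨i, Nat.lt_of_succ_lt h⟩ ∧ b = ⟨i + 1, h⟩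
    · obtain ⟨rfl, rfl⟩ := hab
      simp [adj_left, adj_right, hd]
    · simp only [hab, false_or]
      by_cases hba : b = ⟨i, Nat.lt_of_succ_lt h⟩ ∧ a = ⟨i + 1, h⟩
      · obtain ⟨rfl, rfl⟩ := hba
        simp [adj_left, adj_right, hd.le]
      · have : adj i h a < adj i h b ↔ a < b := by
          rw [Fin.lt_def, Fin.lt_def, adj_val, adj_val]
          simp only [Fin.ext_iff] at hab hba
          split_ifs <;> omega
        rw [this]
  · simp only [mem_image, Prod.mk.injEq, Prod.exists, not_exists]
    rintro a b ⟨h1, h2, h3⟩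
    have h2' : a = ⟨i + 1, h⟩ := by rw [← adj_adj i h a, h2, adj_left]
    have h3' : b = ⟨i, Nat.lt_of_succ_lt h⟩ := by rw [← adj_adj i h b, h3, adj_right]
    subst h2' h3'
    simp [invs] at h1

lemma invs_desc {d : ℕ} (w : Perm (Fin d)) (i : ℕ) (h : i + 1 < d)
    (hd : w ⟨i + 1, h⟩ < w ⟨i, Nat.lt_of_succ_lt h⟩) :
    (invs (w * adj i h)).card + 1 = (invs w).card := by
  have := invs_asc (w * adj i h) i h (by simpa [adj_left, adj_right] using hd)
  rw [mul_assoc, adj_mul, mul_one] at this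
  exact this.symm

lemma asc_or_desc {d : ℕ} (w : Perm (Fin d)) (i : ℕ) (h : i + 1 < d) :
    w ⟨i, Nat.lt_of_succ_lt h⟩ < w ⟨i + 1, h⟩ ∨ w ⟨i + 1, h⟩ < w ⟨i, Nat.lt_of_succ_lt h⟩ := by
  apply lt_or_gt_of_ne
  intro hh
  simpa using w.injective hh

lemma eq_one_of_le {d : ℕ} (w : Perm (Fin d)) (H : ∀ x, w x ≤ x) : w = 1 := by
  have key : ∀ k : ℕ, ∀ x : Fin d, (x : ℕ) = k → w x = x := by
    intro k
    induction k using Nat.strong_induction_on with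
    | _ k ih =>
      intro x hx
      by_contra hne
      have hlt : w x < x := lt_of_le_of_ne (H x) hne
      have := ih (w x) (by rw [← hx]; exact hlt) (w x) rfl
      exact hne (w.injective this)
  ext x
  rw [key x x rfl]; rfl

lemma exists_desc {d : ℕ} (w : Perm (Fin d)) (hw : w ≠ 1) :
    ∃ (i : ℕ) (h : i + 1 < d), w ⟨i + 1, h⟩ < w ⟨i, Nat.lt_of_succ_lt h⟩ := by
  by_contra hcon
  push Not at hcon
  apply hw
  have hstep : ∀ i (h : i + 1 < d), w ⟨i, Nat.lt_of_succ_lt h⟩ < w ⟨i + 1, h⟩ := by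
    intro i h
    rcases asc_or_desc w i h with h1 | h1
    · exact h1
    · exact absurd h1 (not_lt.mpr (hcon i h))
  have hmono : ∀ k a : ℕ, ∀ (h : a + k < d),
      (w ⟨a, by omega⟩ : ℕ) + k ≤ w ⟨a + k, h⟩ := by
    intro k a
    induction k with
    | zero => intro h; simp
    | succ k ih =>
      intro h
      have h1 := ih (by omega)
      have h2 : (w ⟨a + k, by omega⟩ : ℕ) < w ⟨a + k + 1, h⟩ := hstep (a + k) h
      change _ ≤ (w ⟨a + k + 1, h⟩ : ℕ)
      omega
  apply eq_one_of_le
  intro x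
  have hx := x.2
  have h1 := hmono (d - 1 - x) x (by omega)
  have h2 := (w ⟨x + (d - 1 - x), by omega⟩).2
  rw [Fin.le_def]
  have h3 : (w ⟨x, x.2⟩) = w x := rfl
  rw [h3] at h1
  omega

lemma isAdj_adj {d : ℕ} (i : ℕ) (h : i + 1 < d) : IsAdjTrans (adj i h : Perm (Fin d)) := ⟨i, h, rfl⟩

lemma invs_prod_le {d : ℕ} (l : List (Perm (Fin d))) (hl : ∀ s ∈ l, IsAdjTrans s) :
    (invs l.prod).card ≤ l.length := by
  induction l using List.reverseRecOn with
  | nil =>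
    simp only [List.prod_nil, List.length_nil, Nat.le_zero, card_eq_zero]
    rw [Finset.eq_empty_iff_forall_notMem]
    rintro ⟨a, b⟩ hx
    rw [mem_invs] at hx
    exact lt_asymm hx.1 hx.2
  | append_singleton t s ih =>
    obtain ⟨i, h, hs⟩ := hl s (by simp)
    have ih' := ih (fun s hs => hl s (by simp [hs]))
    have hs' : s = adj i h := hs
    simp only [List.prod_append, List.prod_singleton, List.length_append, List.length_singleton]
    rw [hs']
    rcases asc_or_desc t.prod i h with h1 | h1
    · rw [invs_asc _ _ _ h1]; omega
    · have := invs_desc _ _ _ h1; omega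

lemma exists_word {d : ℕ} : ∀ (k : ℕ) (y w : Perm (Fin d)), (invs w).card = k → Dom y w →
    ∃ l : List (Perm (Fin d)), (∀ s ∈ l, IsAdjTrans s) ∧ l.length = k ∧ l.prod = w ∧
      ∃ l' : List (Perm (Fin d)), List.Sublist l' l ∧ l'.prod = y := by
  intro k
  induction k with
  | zero =>
    intro y w hw hd
    have hw1 : w = 1 := by
      by_contra hne
      obtain ⟨i, h, h1⟩ := exists_desc w hne
      have := invs_desc w i h h1
      omega
    subst hw1
    have hy : y = 1 := by
      apply eq_one_of_le
      intro x
      have h1 := hd (x + 1) (x + 1)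
      have h2 : rk (1 : Perm (Fin d)) (x + 1) (x + 1) = 0 := by
        unfold rk
        rw [Finset.card_eq_zero, Finset.filter_eq_empty_iff]
        rintro z -
        simp
      rw [h2, Nat.le_zero] at h1
      unfold rk at h1
      rw [Finset.card_eq_zero, Finset.filter_eq_empty_iff] at h1
      have := h1 (mem_univ x)
      rw [Fin.le_def]
      omega
    exact ⟨[], by simp, rfl, rfl, [], by simp, by simp [hy]⟩
  | succ k ih =>
    intro y w hw hd
    have hw1 : w ≠ 1 := by
      rintro rfl
      have := invs_prod_le ([] : List (Perm (Fin d))) (by simp)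
      simp at this
      rw [this] at hw
      simp at hw
    obtain ⟨i, h, h1⟩ := exists_desc w hw1
    have h2 := invs_desc w i h h1
    have hws : w * adj i h * adj i h = w := by rw [mul_assoc, adj_mul, mul_one]
    rcases asc_or_desc y i h with h3 | h3
    · obtain ⟨l, hl1, hl2, hl3, l', hl4, hl5⟩ := ih y (w * adj i h) (by omega) (by
        apply dom_of_asc _ _ i h h3
        intro p q hp
        rw [rk_mul_adj _ _ _ _ _ hp]
        exact hd p q)
      refine ⟨l ++ [adj i h], ?_, by simp [hl2], by simp [hl3, hws], l',
        hl4.trans (List.sublist_append_left _ _), hl5⟩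
      intro s hs
      simp only [List.mem_append, List.mem_singleton] at hs
      rcases hs with hs | rfl
      · exact hl1 s hs
      · exact isAdj_adj i h
    · obtain ⟨l, hl1, hl2, hl3, l', hl4, hl5⟩ := ih (y * adj i h) (w * adj i h) (by omega) (by
        apply dom_of_asc _ _ i h (by simpa [adj_left, adj_right] using h3)
        intro p q hp
        rw [rk_mul_adj _ _ _ _ _ hp, rk_mul_adj _ _ _ _ _ hp]
        exact hd p q)
      refine ⟨l ++ [adj i h], ?_, by simp [hl2], by simp [hl3, hws], l' ++ [adj i h],
        hl4.append (List.Sublist.refl _), by simp [hl5, mul_assoc, adj_mul]⟩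
      intro s hs
      simp only [List.mem_append, List.mem_singleton] at hs
      rcases hs with hs | rfl
      · exact hl1 s hs
      · exact isAdj_adj i h

lemma len_eq {d : ℕ} (w : Perm (Fin d)) : len w = (invs w).card := by
  obtain ⟨l, h1, h2, h3, -⟩ := exists_word _ w w rfl (fun _ _ => le_rfl)
  apply le_antisymm
  · exact Nat.sInf_le ⟨l, h2, h1, h3⟩
  · have hne : {n | ∃ l : List (Perm (Fin d)),
      l.length = n ∧ (∀ s ∈ l, IsAdjTrans s) ∧ l.prod = w}.Nonempty := ⟨_, l, h2, h1, h3⟩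
    obtain ⟨l', h4, h5, h6⟩ := Nat.sInf_mem hne
    have := invs_prod_le l' h5
    rw [h6, h4] at this
    exact this

lemma dom_of_word {d : ℕ} (l : List (Perm (Fin d))) (hl : ∀ s ∈ l, IsAdjTrans s)
    (hlen : l.length = (invs l.prod).card) :
    ∀ l' : List (Perm (Fin d)), List.Sublist l' l → Dom l'.prod l.prod := by
  induction l using List.reverseRecOn with
  | nil =>
    intro l' h
    rw [List.sublist_nil] at h
    subst h
    exact fun _ _ => le_rfl
  | append_singleton t s ih =>
    obtain ⟨i, h, hs⟩ := hl s (by simp)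
    have hs' : s = adj i h := hs
    clear hs
    subst hs'
    have hlt : ∀ s ∈ t, IsAdjTrans s := fun s hs => hl s (by simp [hs])
    have h0 := invs_prod_le t hlt
    simp only [List.prod_append, List.prod_singleton, List.length_append,
      List.length_singleton] at hlen
    have hasc : t.prod ⟨i, Nat.lt_of_succ_lt h⟩ < t.prod ⟨i + 1, h⟩ := by
      rcases asc_or_desc t.prod i h with h1 | h1
      · exact h1
      · have := invs_desc _ _ _ h1; omega
    have h2 := invs_asc _ _ _ hasc
    have ih' := ih hlt (by omega)
    intro l' hl'
    simp only [List.prod_append, List.prod_singleton]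
    apply dom_of_desc _ _ i h (by simpa [adj_left, adj_right] using hasc)
    intro p q hp
    rw [rk_mul_adj _ _ _ _ _ hp]
    rw [List.sublist_append_iff] at hl'
    obtain ⟨l1, l2, rfl, h3, h4⟩ := hl'
    have h5 := ih' l1 h3 p q
    have h6 : l2 = [] ∨ l2 = [adj i h] := by
      cases h4 with
      | cons _ h => left; simpa using h
      | cons_cons _ h => right; simpa using h
    rcases h6 with rfl | rfl
    · simpa using h5
    · simpa [rk_mul_adj _ _ _ _ _ hp] using h5

lemma bruhat_iff {d : ℕ} (y w : Perm (Fin d)) : BruhatLE y w ↔ Dom y w := by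
  constructor
  · rintro ⟨l, h1, h2, rfl, l', h4, rfl⟩
    rw [len_eq] at h2
    exact dom_of_word l h1 h2 l' h4
  · intro h
    obtain ⟨l, h1, h2, h3, h4⟩ := exists_word _ y w rfl h
    exact ⟨l, h1, by rw [len_eq, h2], h3, h4⟩

lemma rk_inv {d : ℕ} (w : Perm (Fin d)) (p q : ℕ) (hp : p ≤ d) (hq : q ≤ d) :
    rk w⁻¹ q p + p = rk w p q + q := by
  have h1 : rk w⁻¹ q p = (univ.filter (fun x : Fin d => p ≤ (x : ℕ) ∧ (w x : ℕ) < q)).card := by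
    unfold rk
    apply Finset.card_equiv w⁻¹
    intro x
    simp [and_comm]
  have h2 : (univ.filter (fun x : Fin d => p ≤ (x : ℕ) ∧ (w x : ℕ) < q)).card
      + (univ.filter (fun x : Fin d => (x : ℕ) < p ∧ (w x : ℕ) < q)).card = q := by
    have h3 : (univ.filter (fun x : Fin d => (w x : ℕ) < q)).card = q := by
      rw [Finset.card_equiv (t := univ.filter (fun x : Fin d => (x : ℕ) < q)) w (by simp)]
      rw [Fin.card_filter_val_lt]; omega
    conv_rhs => rw [← h3]
    rw [← Finset.card_filter_add_card_filter_not (s := univ.filter (fun x : Fin d => (w x : ℕ) < q))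
      (fun x => p ≤ (x : ℕ))]
    simp only [Finset.filter_filter, not_le, and_comm]
  have h4 : rk w p q
      + (univ.filter (fun x : Fin d => (x : ℕ) < p ∧ (w x : ℕ) < q)).card = p := by
    have h3 : (univ.filter (fun x : Fin d => (x : ℕ) < p)).card = p := by
      rw [Fin.card_filter_val_lt]; omega
    conv_rhs => rw [← h3]
    rw [← Finset.card_filter_add_card_filter_not (s := univ.filter (fun x : Fin d => (x : ℕ) < p))
      (fun x => q ≤ (w x : ℕ))]
    simp only [Finset.filter_filter, not_le, rk]
  omega

lemma conc (f g : ℕ → ℕ) (f0 : ∀ p, f p ≤ f (p + 1)) (f1 : ∀ p, f (p + 1) ≤ f p + 1)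
    (g0 : ∀ p, g p ≤ g (p + 1)) (g1 : ∀ p, g (p + 1) ≤ g p + 1) (a z : ℕ)
    (gc : ∀ p, a ≤ p → p + 1 < z → g (p + 2) + g p ≤ 2 * g (p + 1))
    (ha : f a ≤ g a) (hz : f z ≤ g z) : ∀ p, a ≤ p → p ≤ z → f p ≤ g p := by
  have hflat : ∀ p, a ≤ p → g (p + 1) = g p → ∀ k, p + k + 1 ≤ z →
      g (p + k + 1) = g (p + k) ∧ g (p + k + 1) = g p := by
    intro p hp h k
    induction k with
    | zero => intro _; exact ⟨h, h⟩
    | succ k ih =>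
      intro hk
      obtain ⟨h1, h2⟩ := ih (by omega)
      have h3 := gc (p + k) (by omega) (by omega)
      have h4 := g0 (p + k + 1)
      have e1 : p + k + 2 = p + k + 1 + 1 := rfl
      have e2 : p + (k + 1) = p + k + 1 := rfl
      rw [e1] at h3
      rw [e2]
      omega
  have hfm : Monotone f := monotone_nat_of_le_succ f0
  intro p hp
  induction p, hp using Nat.le_induction with
  | base => intro _; exact ha
  | succ p hp ih =>
    intro hpz
    have h1 := ih (by omega)
    by_cases h : g (p + 1) = g p
    · obtain ⟨-, h2⟩ := hflat p hp h (z - p - 1) (by omega)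
      rw [show p + (z - p - 1) + 1 = z by omega] at h2
      have := hfm hpz
      omega
    · have := f1 p
      have := g0 p
      omega

/-- prefix sums -/
def pre {n : ℕ} (b : Fin n → ℕ) (k : ℕ) : ℕ := ∑ i ∈ univ.filter (fun i : Fin n => (i : ℕ) < k), b i

lemma pre_zero {n : ℕ} (b : Fin n → ℕ) : pre b 0 = 0 := by simp [pre]

lemma pre_mono {n : ℕ} (b : Fin n → ℕ) : Monotone (pre b) := by
  intro k l h
  unfold pre
  apply Finset.sum_le_sum_of_subset
  intro x
  simp only [mem_filter, mem_univ, true_and]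
  omega

lemma pre_top {n : ℕ} (b : Fin n → ℕ) : pre b n = ∑ i, b i := by simp [pre]

lemma mem_block {d n : ℕ} (b : Fin n → ℕ) (i : Fin n) (x : Fin d) :
    x ∈ block d b i ↔ pre b i ≤ x ∧ (x : ℕ) < pre b (i + 1) := by
  simp only [block, mem_filter, mem_univ, true_and, pre, Fin.lt_def, Fin.le_def, Nat.lt_succ_iff]

lemma exists_block {d n : ℕ} (b : Fin n → ℕ) (hb : ∑ i, b i = d) (x : ℕ) (hx : x < d) :
    ∃ i : Fin n, pre b i ≤ x ∧ x < pre b (i + 1) := by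
  have key : ∀ k, k ≤ n → x < pre b k → ∃ i : Fin n, pre b i ≤ x ∧ x < pre b (i + 1) := by
    intro k
    induction k with
    | zero => intro _ h; simp [pre_zero] at h
    | succ k ih =>
      intro hk h
      by_cases h1 : x < pre b k
      · exact ih (by omega) h1
      · exact ⟨⟨k, hk⟩, by simpa using h1, h⟩
  exact key n le_rfl (by rw [pre_top, hb]; exact hx)

lemma exists_index {d n : ℕ} (b : Fin n → ℕ) (hb : ∑ i, b i = d) :
    ∃ f : Fin d → Fin n, (∀ x i, x ∈ block d b i ↔ f x = i) ∧
      (∀ (x : Fin d) (i : Fin n), (x : ℕ) < pre b (i + 1) ↔ f x ≤ i) ∧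
      (∀ (x : Fin d) (i : Fin n), pre b i ≤ x ↔ i ≤ f x) := by
  have hex := fun x : Fin d => exists_block b hb x x.2
  choose f hf using hex
  have h1 : ∀ (x : Fin d) (i : Fin n), (x : ℕ) < pre b (i + 1) ↔ f x ≤ i := by
    intro x i
    constructor
    · intro h
      by_contra hc
      have : pre b (i + 1) ≤ pre b (f x) := pre_mono b (by rw [Fin.le_def] at hc; omega)
      have := (hf x).1
      omega
    · intro h
      have : pre b (f x + 1) ≤ pre b (i + 1) := pre_mono b (by rw [Fin.le_def] at h; omega)
      have := (hf x).2
      omega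
  have h2 : ∀ (x : Fin d) (i : Fin n), pre b i ≤ x ↔ i ≤ f x := by
    intro x i
    constructor
    · intro h
      by_contra hc
      have : pre b (f x + 1) ≤ pre b i := pre_mono b (by rw [Fin.le_def] at hc; omega)
      have := (hf x).2
      omega
    · intro h
      have : pre b i ≤ pre b (f x) := pre_mono b h
      have := (hf x).1
      omega
  refine ⟨f, ?_, h1, h2⟩
  intro x i
  rw [mem_block, h1, h2]
  exact ⟨fun h => le_antisymm h.2 h.1, fun h => ⟨h.ge, h.le⟩⟩

lemma sUR_psi {d n n' : ℕ} (b : Fin n → ℕ) (c : Fin n' → ℕ)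
    (hb : ∑ i, b i = d) (hc : ∑ j, c j = d) (w : Perm (Fin d)) (i : Fin n) (j : Fin n') :
    sUR (psi d b c w) i j = rk w (pre b (i + 1)) (pre c j) := by
  obtain ⟨f, hf, hf1, -⟩ := exists_index b hb
  obtain ⟨g, hg, -, hg1⟩ := exists_index c hc
  have hpsi : ∀ i j, psi d b c w i j = ∑ x : Fin d, if f x = i then (if g (w x) = j then 1 else 0) else 0 := by
    intro i j
    unfold psi
    have : block d b i = univ.filter (fun x => f x = i) := by ext x; simp [hf]
    rw [this, Finset.card_filter, Finset.sum_filter]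
    simp only [hg]
  unfold sUR rk
  simp only [hpsi, hf1, hg1]
  rw [Finset.card_filter]
  have : ∀ i', (∑ j' ∈ univ.filter (fun j' => j ≤ j'), ∑ x : Fin d,
      if f x = i' then (if g (w x) = j' then 1 else 0) else 0)
      = ∑ x : Fin d, if f x = i' then (if j ≤ g (w x) then 1 else 0) else 0 := by
    intro i'
    rw [Finset.sum_comm]
    apply Finset.sum_congr rfl
    intro x _
    split_ifs <;> simp_all
  simp only [this]
  rw [Finset.sum_comm]
  apply Finset.sum_congr rfl
  intro x _
  by_cases h1 : f x ≤ i <;> by_cases h2 : j ≤ g (w x) <;> simp [h1, h2]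

lemma psi_inv {d n n' : ℕ} (b : Fin n → ℕ) (c : Fin n' → ℕ) (w : Perm (Fin d)) (i : Fin n)
    (j : Fin n') : psi d c b w⁻¹ j i = psi d b c w i j := by
  unfold psi
  apply Finset.card_equiv w⁻¹
  intro x
  simp [and_comm]

lemma invs_inv {d : ℕ} (w : Perm (Fin d)) : (invs w⁻¹).card = (invs w).card := by
  apply Finset.card_equiv ((Equiv.prodComm _ _).trans (Equiv.prodCongr w⁻¹ w⁻¹))
  rintro ⟨a, b⟩
  simp [invs, and_comm]

lemma max_desc {d n n' : ℕ} (b : Fin n → ℕ) (c : Fin n' → ℕ) (w : Perm (Fin d))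
    (hmax : ∀ y : Perm (Fin d), psi d b c y = psi d b c w → (invs y).card ≤ (invs w).card)
    (k : Fin n) (i : ℕ) (h : i + 1 < d) (h1 : pre b k ≤ i) (h2 : i + 1 < pre b (k + 1)) :
    w ⟨i + 1, h⟩ < w ⟨i, Nat.lt_of_succ_lt h⟩ := by
  rcases asc_or_desc w i h with h3 | h3
  · exfalso
    have h4 := invs_asc w i h h3
    have h5 := hmax (w * adj i h) (by
      funext k' j
      unfold psi
      apply Finset.card_equiv (adj i h)
      intro x
      rw [mem_filter, mem_filter]
      simp only [Perm.mul_apply]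
      have : adj i h x ∈ block d b k' ↔ x ∈ block d b k' := by
        rw [mem_block, mem_block, adj_val]
        rcases lt_trichotomy k' k with hk | hk | hk
        · have : pre b (k' + 1) ≤ pre b k := pre_mono b (by rw [Fin.lt_def] at hk; omega)
          split_ifs <;> omega
        · subst hk
          split_ifs <;> omega
        · have : pre b (k + 1) ≤ pre b k' := pre_mono b (by rw [Fin.lt_def] at hk; omega)
          split_ifs <;> omega
      rw [this])
    omega
  · exact h3

lemma block_dom {d n n' : ℕ} (b : Fin n → ℕ) (c : Fin n' → ℕ) (hb : ∑ i, b i = d)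
    (w w' : Perm (Fin d))
    (hmax : ∀ y : Perm (Fin d), psi d b c y = psi d b c w' → (invs y).card ≤ (invs w').card)
    (q : ℕ) (H : ∀ k, k ≤ n → rk w (pre b k) q ≤ rk w' (pre b k) q) (p : ℕ) :
    rk w p q ≤ rk w' p q := by
  by_cases hp : p < d
  · obtain ⟨k, h1, h2⟩ := exists_block b hb p hp
    refine conc (fun p => rk w p q) (fun p => rk w' p q) ?_ ?_ ?_ ?_ (pre b k) (pre b (k + 1)) ?_
      (H _ k.2.le) (H _ k.2) p h1 h2.le
    · intro p; simp only [rk_succ]; omega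
    · intro p; have := stp_le w q p; simp only [rk_succ]; omega
    · intro p; simp only [rk_succ]; omega
    · intro p; have := stp_le w' q p; simp only [rk_succ]; omega
    · intro p hp1 hp2
      have h4 : pre b (k + 1) ≤ d := by
        rw [← hb, ← pre_top]; exact pre_mono b k.2
      have h3 := stp_desc w' q p (by omega) (max_desc b c w' hmax k p (by omega) hp1 hp2)
      change rk w' (p + 1 + 1) q + _ ≤ _
      simp only [rk_succ]
      omega
  · have := H n le_rfl
    rw [pre_top, hb] at this
    rw [rk_big_p w p q (by omega), rk_big_p w' p q (by omega)]
    exact this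

theorem stmt10 (d n n' : ℕ) (b : Fin n → ℕ) (c : Fin n' → ℕ)
    (hb : ∑ i, b i = d) (hc : ∑ j, c j = d)
    (m m' : Fin n → Fin n' → ℕ) (hm : MemM b c m) (hm' : MemM b c m')
    (w w' : Perm (Fin d)) (hw : psi d b c w = m) (hw' : psi d b c w' = m')
    (hmax : ∀ y : Perm (Fin d), psi d b c y = m → len y ≤ len w)
    (hmax' : ∀ y : Perm (Fin d), psi d b c y = m' → len y ≤ len w') :
    BruhatLE w w' ↔ ∀ (i : Fin n) (j : Fin n'), sUR m i j ≤ sUR m' i j := by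

  subst hw hw'
  simp only [len_eq] at hmax'
  rw [bruhat_iff]
  simp only [sUR_psi b c hb hc]
  constructor
  · intro h i j
    exact h _ _
  · intro H
    have preb : ∀ k, k ≤ n → pre b k ≤ d := fun k hk => by
      rw [← hb, ← pre_top]; exact pre_mono b hk
    have prec : ∀ k, k ≤ n' → pre c k ≤ d := fun k hk => by
      rw [← hc, ← pre_top]; exact pre_mono c hk
    have corner : ∀ k l, k ≤ n → l ≤ n' →
        rk w (pre b k) (pre c l) ≤ rk w' (pre b k) (pre c l) := by
      intro k l hk hl
      rcases Nat.eq_zero_or_pos k with rfl | hk0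
      · simp [pre_zero, rk_zero]
      · rcases Nat.eq_or_lt_of_le hl with rfl | hl0
        · rw [rk_big_q _ _ _ (by rw [pre_top, hc])]
          exact Nat.zero_le _
        · have := H ⟨k - 1, by omega⟩ ⟨l, hl0⟩
          simpa [Nat.sub_add_cancel hk0] using this
    have s1 : ∀ l, l ≤ n' → ∀ p, rk w p (pre c l) ≤ rk w' p (pre c l) := fun l hl =>
      block_dom b c hb w w' hmax' _ (fun k hk => corner k l hk hl)
    have hmaxi : ∀ y : Perm (Fin d), psi d c b y = psi d c b w'⁻¹ →
        (invs y).card ≤ (invs w'⁻¹).card := by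
      intro y hy
      rw [invs_inv, ← invs_inv y]
      apply hmax'
      funext i j
      rw [psi_inv, hy, psi_inv]
    have s2 : ∀ p, p ≤ d → ∀ q, rk w⁻¹ q p ≤ rk w'⁻¹ q p := fun p hp =>
      block_dom c b hc w⁻¹ w'⁻¹ hmaxi p (fun l hl => by
        have h1 := rk_inv w p (pre c l) hp (prec l hl)
        have h2 := rk_inv w' p (pre c l) hp (prec l hl)
        have h3 := s1 l hl p
        omega)
    have s3 : ∀ p q, p ≤ d → rk w p q ≤ rk w' p q := by
      intro p q hp
      by_cases hq : q ≤ d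
      · have h1 := rk_inv w p q hp hq
        have h2 := rk_inv w' p q hp hq
        have h3 := s2 p hp q
        omega
      · rw [rk_big_q _ _ _ (by omega)]
        exact Nat.zero_le _
    intro p q
    by_cases hp : p ≤ d
    · exact s3 p q hp
    · rw [rk_big_p w p q (by omega), rk_big_p w' p q (by omega)]
      exact s3 d q le_rfl
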